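/- Let S be a set of linearization points and F : S → ℝ^{n×n}, H : S → ℝ^{p×n}. Suppose V_k ⊆ ℝ^n (k ∈ ℕ) are subspaces such that for every s ∈ S and every k: V_k ⊆ ker(H(s)) and F(s) '' V_k ⊆ V_{k+1}, and suppose there is a nominal sequence x⁰ : ℕ → S with N(x⁰,k) = V_k for all k. Then: (i) V_k ⊆ N(x,k) for every sequence x and every k, and (ii) the estimator unobservable subspace N̂_k := ⋂_{x : ℕ → S} N(x,k) satisfies N̂_k = V_k = N(x⁰,k) for all k. That is, if the nominal unobservable subspace admits a state-independent (constant) description, then the estimator system's unobservable subspace exactly matches the nominal one (observability matching). -/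

import Mathlib

open Matrix

/-- Ordered product `A_{k+ℓ-1} ⋯ A_k` of the state-propagation matrices,
with the empty product (`ℓ = 0`) equal to the identity. -/
def obsProd {n : ℕ} (A : ℕ → Matrix (Fin n) (Fin n) ℝ) : ℕ → ℕ → Matrix (Fin n) (Fin n) ℝ
  | _, 0 => 1
  | k, ℓ + 1 => A (k + ℓ) * obsProd A k ℓ

/-- The unobservable subspace at time `k` along a sequence `x` of linearization points:
`N(x,k) = ⋂_{ℓ ≥ 0} ker (H(x_{k+ℓ}) · F(x_{k+ℓ-1}) ⋯ F(x_k))`. -/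
def unobsAlong {n q : ℕ} {S : Type*} (F : S → Matrix (Fin n) (Fin n) ℝ)
    (H : S → Matrix (Fin q) (Fin n) ℝ) (x : ℕ → S) (k : ℕ) : Submodule ℝ (Fin n → ℝ) :=
  ⨅ ℓ : ℕ, LinearMap.ker
    (Matrix.mulVecLin (H (x (k + ℓ)) * obsProd (fun i => F (x i)) k ℓ))

/-- A family of subspaces that is forward-invariant under every propagation matrix is carried
from time `k` to time `k + ℓ` by the ordered product. -/
theorem obsProd_mulVec_mem {n : ℕ} {A : ℕ → Matrix (Fin n) (Fin n) ℝ}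
    {V : ℕ → Submodule ℝ (Fin n → ℝ)}
    (hA : ∀ i j, Submodule.map (Matrix.mulVecLin (A i)) (V j) ≤ V (j + 1))
    {k : ℕ} {v : Fin n → ℝ} (hv : v ∈ V k) (ℓ : ℕ) :
    obsProd A k ℓ *ᵥ v ∈ V (k + ℓ) := by
  induction ℓ with
  | zero => simpa [obsProd] using hv
  | succ ℓ ih =>
    rw [obsProd, ← Matrix.mulVec_mulVec]
    exact hA (k + ℓ) (k + ℓ) (Submodule.mem_map_of_mem ih)

/-- Observability matching: if the nominal unobservable subspace admits a state-independent
description `V_k` (lying in every measurement kernel and forward-invariant under every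
propagation Jacobian) realized along a nominal sequence `x⁰`, then `V_k` is contained in the
unobservable subspace along every sequence, and the estimator unobservable subspace
`N̂_k := ⋂_x N(x,k)` exactly matches the nominal one: `N̂_k = V_k = N(x⁰,k)`. -/
theorem observability_matching {n q : ℕ} {S : Type*}
    (F : S → Matrix (Fin n) (Fin n) ℝ) (H : S → Matrix (Fin q) (Fin n) ℝ)
    (V : ℕ → Submodule ℝ (Fin n → ℝ))
    (hker : ∀ (s : S) (k : ℕ), V k ≤ LinearMap.ker (Matrix.mulVecLin (H s)))
    (hinv : ∀ (s : S) (k : ℕ), Submodule.map (Matrix.mulVecLin (F s)) (V k) ≤ V (k + 1))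
    (x0 : ℕ → S) (hx0 : ∀ k, unobsAlong F H x0 k = V k) :
    (∀ (x : ℕ → S) (k : ℕ), V k ≤ unobsAlong F H x k) ∧
      ∀ k : ℕ, (⨅ x : ℕ → S, unobsAlong F H x k) = V k := by
  have hle : ∀ (x : ℕ → S) (k : ℕ), V k ≤ unobsAlong F H x k := by
    refine fun x k => le_iInf fun ℓ v hv => ?_
    rw [LinearMap.mem_ker, Matrix.mulVecLin_apply, ← Matrix.mulVec_mulVec]
    exact hker (x (k + ℓ)) (k + ℓ) (obsProd_mulVec_mem (fun i j => hinv (x i) j) hv ℓ)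
  exact ⟨hle, fun k => le_antisymm ((iInf_le _ x0).trans (hx0 k).le) (le_iInf fun x => hle x k)⟩
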